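/- arXiv:1911.12940 — 3 statements merged into one kernel-verified Lean document; each statement's English description precedes it below -/
import Mathlib

section
/- For a regular T2 space X the following are equivalent: (1) X is metrizable; (2) 𝒦(X) has a σ-locally finite weak base; (3) 𝒦(X) is metrizable. -/
open TopologicalSpace Set

/-- The hyperspace `𝒦(X)` of nonempty compact subsets of `X`. -/
structure VHyper (X : Type*) [TopologicalSpace X] where
  carrier : Set X
  isCompact' : IsCompact carrier
  nonempty' : carrier.Nonempty

namespace VHyper

variable {X : Type*} [TopologicalSpace X]

/-- The basic Vietoris set `⟨P₁, …, P_r⟩` determined by a finite family of subsets of `X`: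
all nonempty compact sets contained in the union and meeting every member. -/
def vbox (Ps : Finset (Set X)) : Set (VHyper X) :=
  {A : VHyper X | A.carrier ⊆ ⋃₀ (Ps : Set (Set X)) ∧ ∀ P ∈ Ps, (A.carrier ∩ P).Nonempty}

/-- The Vietoris topology on `𝒦(X)`, generated by the sets `⟨U₁, …, U_k⟩`
with all `U_i` open. -/
instance : TopologicalSpace (VHyper X) :=
  TopologicalSpace.generateFrom
    {S : Set (VHyper X) | ∃ Ps : Finset (Set X), (∀ U ∈ Ps, IsOpen U) ∧ S = vbox Ps}

end VHyper

/-- `ℱ(X)`: the subspace of `𝒦(X)` consisting of the nonempty finite subsets of `X`. -/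
def VFin (X : Type*) [TopologicalSpace X] := {A : VHyper X // A.carrier.Finite}

instance (X : Type*) [TopologicalSpace X] : TopologicalSpace (VFin X) :=
  inferInstanceAs (TopologicalSpace {A : VHyper X // A.carrier.Finite})

/-- `ℱ₂(X)`: the subspace of `𝒦(X)` consisting of the nonempty subsets of `X` of
cardinality at most 2. -/
def VFin2 (X : Type*) [TopologicalSpace X] := {A : VHyper X // A.carrier.encard ≤ 2}

instance (X : Type*) [TopologicalSpace X] : TopologicalSpace (VFin2 X) :=
  inferInstanceAs (TopologicalSpace {A : VHyper X // A.carrier.encard ≤ 2})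

/-- The family `ℬ = {⟨P₁,…,P_r⟩ : P₁,…,P_r ∈ Pfam, r ∈ ℕ}` of basic Vietoris sets built from
members of `Pfam`. -/
def boxFamily {X : Type*} [TopologicalSpace X] (Pfam : Set (Set X)) : Set (Set (VHyper X)) :=
  {B | ∃ Ps : Finset (Set X), Ps.Nonempty ∧ ↑Ps ⊆ Pfam ∧ B = VHyper.vbox Ps}

section Defs

variable {Y : Type*} [TopologicalSpace Y]

/-- `Pfam` is a k-network: for every compact `C` and open `U ⊇ C` there is a finite
subfamily `Qfam ⊆ Pfam` with `C ⊆ ⋃Qfam ⊆ U`. -/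
def IsKNetwork (Pfam : Set (Set Y)) : Prop :=
  ∀ C : Set Y, IsCompact C → ∀ U : Set Y, IsOpen U → C ⊆ U →
    ∃ Qfam : Set (Set Y), Qfam ⊆ Pfam ∧ Qfam.Finite ∧ C ⊆ ⋃₀ Qfam ∧ ⋃₀ Qfam ⊆ U

/-- Every point lies in at most countably many members of `Pfam`. -/
def PointCountableFam (Pfam : Set (Set Y)) : Prop :=
  ∀ y : Y, {P ∈ Pfam | y ∈ P}.Countable

/-- Every compact set meets at most countably many members of `Pfam`. -/
def CompactCountableFam (Pfam : Set (Set Y)) : Prop :=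
  ∀ C : Set Y, IsCompact C → {P ∈ Pfam | (C ∩ P).Nonempty}.Countable

/-- Every point has a neighborhood meeting at most countably many members of `Pfam`. -/
def LocallyCountableFam (Pfam : Set (Set Y)) : Prop :=
  ∀ y : Y, ∃ O ∈ nhds y, {P ∈ Pfam | (O ∩ P).Nonempty}.Countable

/-- Every point has a neighborhood meeting only finitely many members of `Pfam`. -/
def LocallyFiniteFam (Pfam : Set (Set Y)) : Prop :=
  ∀ y : Y, ∃ O ∈ nhds y, {P ∈ Pfam | (O ∩ P).Nonempty}.Finite

/-- Every compact set meets only finitely many members of `Pfam`. -/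
def CompactFiniteFam (Pfam : Set (Set Y)) : Prop :=
  ∀ C : Set Y, IsCompact C → {P ∈ Pfam | (C ∩ P).Nonempty}.Finite

/-- `Pfam` is a base for the topology: all members are open, and every open set is a union of
members around each of its points. -/
def IsBaseFam (Pfam : Set (Set Y)) : Prop :=
  (∀ P ∈ Pfam, IsOpen P) ∧ ∀ U : Set Y, IsOpen U → ∀ y ∈ U, ∃ P ∈ Pfam, y ∈ P ∧ P ⊆ U

/-- `Pfam` is hereditarily closure-preserving: whenever `S P ⊆ P` is chosen for each `P ∈ Pfam`,
the resulting family is closure-preserving. -/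
def IsHCP (Pfam : Set (Set Y)) : Prop :=
  ∀ S : Set Y → Set Y, (∀ P ∈ Pfam, S P ⊆ P) →
    ∀ Qfam ⊆ Pfam, closure (⋃ P ∈ Qfam, S P) = ⋃ P ∈ Qfam, closure (S P)

/-- `Pfam = ⋃_{y} Pfam y` is a weak base: each `Pfam y` consists of sets containing `y`, is directed
downward, every open neighborhood of `y` contains a member of `Pfam y`, and a set `G` is open
whenever each of its points has a member of its family inside `G`. -/
def IsWeakBase (Pfam : Y → Set (Set Y)) : Prop :=
  (∀ y, ∀ P ∈ Pfam y, y ∈ P) ∧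
  (∀ y, ∀ U ∈ Pfam y, ∀ V ∈ Pfam y, ∃ W ∈ Pfam y, W ⊆ U ∩ V) ∧
  (∀ y, ∀ U : Set Y, IsOpen U → y ∈ U → ∃ P ∈ Pfam y, P ⊆ U) ∧
  (∀ G : Set Y, (∀ y ∈ G, ∃ P ∈ Pfam y, P ⊆ G) → IsOpen G)

end Defs

/-- An ℵ-space: a space with a σ-locally finite k-network. -/
def IsAlephSpace (Y : Type*) [TopologicalSpace Y] : Prop :=
  ∃ Pfam : ℕ → Set (Set Y), (∀ n, LocallyFiniteFam (Pfam n)) ∧ IsKNetwork (⋃ n, Pfam n)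

/-- A space with a σ-hereditarily closure-preserving k-network. -/
def HasSigmaHCPKNetwork (Y : Type*) [TopologicalSpace Y] : Prop :=
  ∃ Pfam : ℕ → Set (Set Y), (∀ n, IsHCP (Pfam n)) ∧ IsKNetwork (⋃ n, Pfam n)

/-- k*-metrizable: a space with a σ-compact-finite k-network. -/
def KStarMetrizable (Y : Type*) [TopologicalSpace Y] : Prop :=
  ∃ Pfam : ℕ → Set (Set Y), (∀ n, CompactFiniteFam (Pfam n)) ∧ IsKNetwork (⋃ n, Pfam n)

open Filter Topology

/-- Nagata–Smirnov metrization. -/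
theorem nagata_smirnov_aux {X : Type*} [TopologicalSpace X] [T2Space X] [RegularSpace X]
    {I : ℕ → Type*} (U : ∀ n, I n → Set X) (ho : ∀ n i, IsOpen (U n i))
    (hlf : ∀ n, LocallyFinite (U n))
    (hb : ∀ x, ∀ O ∈ 𝓝 x, ∃ n i, x ∈ U n i ∧ U n i ⊆ O) : MetrizableSpace X := by
  have hb' : ∀ x, ∀ O ∈ 𝓝 x, ∃ n i, x ∈ U n i ∧ closure (U n i) ⊆ O := by
    intro x O hO
    obtain ⟨t, ht, htc, hts⟩ := exists_mem_nhds_isClosed_subset hO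
    obtain ⟨n, i, hx, hi⟩ := hb x t ht
    exact ⟨n, i, hx, (closure_minimal hi htc).trans hts⟩
  have hsep : ∀ s t : Set X, IsClosed t → Disjoint s t → HasSeparatingCover s t := by
    intro s t ht hst
    refine ⟨fun n => ⋃ i : {i : I n // Disjoint (closure (U n i)) t}, U n i, ?_, ?_⟩
    · intro x hx
      obtain ⟨n, i, hxi, hi⟩ := hb' x tᶜ (ht.isOpen_compl.mem_nhds (disjoint_left.1 hst hx))
      exact mem_iUnion.2 ⟨n, mem_iUnion.2 ⟨⟨i, disjoint_left.2 fun a ha => hi ha⟩, hxi⟩⟩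
    · intro n
      refine ⟨isOpen_iUnion fun i => ho _ _, ?_⟩
      have h := ((hlf n).comp_injective
        (g := fun i : {i : I n // Disjoint (closure (U n i)) t} => i.1)
        Subtype.val_injective).closure_iUnion
      simp only [Function.comp_apply] at h
      change Disjoint (closure (⋃ i : {i : I n // Disjoint (closure (U n i)) t}, U n i)) t
      rw [h, disjoint_iUnion_left]
      exact fun i => i.2
  haveI : NormalSpace X := ⟨fun s t hs ht hst =>
    hasSeparatingCovers_iff_separatedNhds.1 ⟨hsep s t ht hst, hsep t s hs hst.symm⟩⟩
  have hf : ∀ p : ℕ × ℕ, ∀ i : I p.2, ∃ f : C(X, ℝ), EqOn f 0 (U p.2 i)ᶜ ∧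
      ∀ j : I p.1, closure (U p.1 j) ⊆ U p.2 i → EqOn f 1 (U p.1 j) := by
    intro p i
    have hc : IsClosed (⋃ j : {j : I p.1 // closure (U p.1 j) ⊆ U p.2 i}, closure (U p.1 j)) := by
      have := ((hlf p.1).closure.comp_injective
        (g := fun j : {j : I p.1 // closure (U p.1 j) ⊆ U p.2 i} => j.1) Subtype.val_injective)
      exact this.isClosed_iUnion fun _ => isClosed_closure
    obtain ⟨f, h0, h1, -⟩ := exists_continuous_zero_one_of_isClosed (ho p.2 i).isClosed_compl hc (by
      rw [disjoint_compl_left_iff_subset]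
      exact iUnion_subset fun j => j.2)
    exact ⟨f, h0, fun j hj x hx => h1 (mem_iUnion.2 ⟨⟨j, hj⟩, subset_closure hx⟩)⟩
  choose f hf0 hf1 using hf
  let F : X → ∀ p : ℕ × ℕ, UniformFun (I p.2) ℝ := fun x p => UniformFun.ofFun fun i => f p i x
  have hFc : Continuous F := by
    refine continuous_pi fun p => continuous_iff_continuousAt.2 fun x => ?_
    rw [ContinuousAt, UniformFun.tendsto_iff_tendstoUniformly, Metric.tendstoUniformly_iff]
    intro ε hε
    obtain ⟨t, ht, hfin⟩ := hlf p.2 x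
    have h1 : ∀ᶠ y in 𝓝 x, ∀ i ∈ {i | (U p.2 i ∩ t).Nonempty}, dist (f p i x) (f p i y) < ε := by
      rw [eventually_all_finite hfin]
      intro i _
      have := (f p i).continuous.continuousAt (x := x)
      have := Metric.tendsto_nhds.1 this ε hε
      filter_upwards [this] with y hy
      rwa [dist_comm]
    filter_upwards [h1, ht] with y hy hyt i
    by_cases hi : (U p.2 i ∩ t).Nonempty
    · exact hy i hi
    · have hz : ∀ z ∈ t, f p i z = 0 := fun z hz => hf0 p i (fun hzU => hi ⟨z, hzU, hz⟩)
      change dist (f p i x) (f p i y) < ε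
      rw [hz x (mem_of_mem_nhds ht), hz y hyt]
      simpa using hε
  have hFi : IsInducing F := by
    rw [isInducing_iff_nhds]
    intro x
    refine le_antisymm (hFc.continuousAt.tendsto.le_comap) ?_
    intro O hO
    obtain ⟨n, i, hxi, hi⟩ := hb x O hO
    obtain ⟨m, j, hxj, hj⟩ := hb' x (U n i) ((ho n i).mem_nhds hxi)
    have hev : Continuous fun g : (∀ p : ℕ × ℕ, UniformFun (I p.2) ℝ) =>
        UniformFun.toFun (g (m, n)) i :=
      (UniformFun.uniformContinuous_eval ℝ i).continuous.comp (continuous_apply (m, n))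
    refine mem_comap.2 ⟨_, (hev.isOpen_preimage _ (isOpen_Ioi (a := (0:ℝ)))).mem_nhds ?_, ?_⟩
    · change 0 < f (m, n) i x
      have : f (m, n) i x = 1 := hf1 (m, n) i j hj hxj
      rw [this]; exact one_pos
    · intro y hy
      change 0 < f (m, n) i y at hy
      by_contra hyO
      have : f (m, n) i y = 0 := hf0 (m, n) i (fun h => hyO (hi h))
      exact hy.ne' this
  haveI : PseudoMetrizableSpace (∀ p : ℕ × ℕ, UniformFun (I p.2) ℝ) := inferInstance
  haveI := hFi.pseudoMetrizableSpace
  infer_instance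

section WB

variable {Y : Type*} [TopologicalSpace Y]

theorem wb_eventually [T2Space Y] {W : Y → Set (Set Y)} (hW : IsWeakBase W) {z : ℕ → Y} {y : Y}
    (hz : Tendsto z atTop (𝓝 y)) {P : Set Y} (hP : P ∈ W y) : ∀ᶠ k in atTop, z k ∈ P := by
  by_contra hcon
  obtain ⟨φ, hφ, hφP⟩ := extraction_of_frequently_atTop (not_eventually.1 hcon)
  have hw : Tendsto (z ∘ φ) atTop (𝓝 y) := hz.comp hφ.tendsto_atTop
  have hcl : IsClosed (insert y (range (z ∘ φ))) := hw.isCompact_insert_range.isClosed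
  have hop : IsOpen (range (z ∘ φ))ᶜ := by
    refine hW.2.2.2 _ fun u hu => ?_
    by_cases huy : u = y
    · subst huy
      refine ⟨P, hP, ?_⟩
      rintro v hv ⟨k, rfl⟩
      exact hφP k hv
    · obtain ⟨Q, hQ, hQs⟩ := hW.2.2.1 u _ hcl.isOpen_compl (by
        rintro (h | h)
        · exact huy h
        · exact hu h)
      exact ⟨Q, hQ, hQs.trans (compl_subset_compl.2 (subset_insert _ _))⟩
  have hy : y ∈ (range (z ∘ φ))ᶜ := by
    rintro ⟨k, hk⟩
    exact hφP k (by have := hW.1 y P hP; rw [← hk] at this; exact this)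
  obtain ⟨k, hk⟩ := (hw.eventually (hop.mem_nhds hy)).exists
  exact hk ⟨k, rfl⟩

theorem wb_seq {W : Y → Set (Set Y)} (hW : IsWeakBase W) (y : Y) (hc : (W y).Countable) :
    ∃ p : ℕ → Set Y, (∀ n, p n ∈ W y) ∧ ∀ U ∈ 𝓝 y, ∀ᶠ n in atTop, p n ⊆ U := by
  obtain ⟨P0, hP0, -⟩ := hW.2.2.1 y univ isOpen_univ trivial
  obtain ⟨e, he⟩ := hc.exists_eq_range ⟨P0, hP0⟩
  have hmem : ∀ n, e n ∈ W y := fun n => by rw [he]; exact ⟨n, rfl⟩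
  choose c hc1 hc2 using hW.2.1 y
  let p : ℕ → {P // P ∈ W y} := fun n => Nat.rec ⟨e 0, hmem 0⟩
    (fun k q => ⟨c q.1 q.2 (e (k+1)) (hmem _), hc1 _ _ _ _⟩) n
  have hs : ∀ k, (p (k+1)).1 ⊆ (p k).1 ∩ e (k+1) := fun k => hc2 _ _ _ _
  have hanti : Antitone fun n => (p n).1 :=
    antitone_nat_of_succ_le fun k => (hs k).trans inter_subset_left
  refine ⟨fun n => (p n).1, fun n => (p n).2, fun U hU => ?_⟩
  obtain ⟨V, hVU, hV, hyV⟩ := mem_nhds_iff.1 hU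
  obtain ⟨Q, hQ, hQV⟩ := hW.2.2.1 y V hV hyV
  rw [he] at hQ
  obtain ⟨n, rfl⟩ := hQ
  have hn : (p n).1 ⊆ e n := by
    cases n with
    | zero => exact subset_rfl
    | succ k => exact (hs k).trans inter_subset_right
  filter_upwards [eventually_ge_atTop n] with k hk
  exact (hanti hk).trans (hn.trans (hQV.trans hVU))

theorem wb_seqClosed {W : Y → Set (Set Y)} (hW : IsWeakBase W) (hc : ∀ y, (W y).Countable)
    {A : Set Y} (hA : IsSeqClosed A) : IsClosed A := by
  rw [← isOpen_compl_iff]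
  refine hW.2.2.2 _ fun y hy => ?_
  by_contra! hcon
  obtain ⟨p, hp, hpU⟩ := wb_seq hW y (hc y)
  have : ∀ n, ∃ z ∈ p n, z ∈ A := fun n => by
    obtain ⟨z, hz, hzA⟩ := not_subset.1 (hcon _ (hp n))
    exact ⟨z, hz, not_not.1 hzA⟩
  choose z hz hzA using this
  refine hy (hA hzA (tendsto_def.2 fun U hU => ?_))
  filter_upwards [hpU U hU] with n hn
  exact hn (hz n)

end WB

namespace VHyper

variable {X : Type*} [TopologicalSpace X]

theorem isOpen_sub {U : Set X} (hU : IsOpen U) : IsOpen {A : VHyper X | A.carrier ⊆ U} := by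
  refine isOpen_generateFrom_of_mem ⟨{U}, by simpa using hU, ?_⟩
  ext A
  simp only [vbox, mem_ofPred_eq, Finset.coe_singleton, sUnion_singleton, Finset.mem_singleton,
    forall_eq]
  refine ⟨fun h => ⟨h, ?_⟩, fun h => h.1⟩
  rw [inter_eq_left.2 h]
  exact A.nonempty'

theorem isOpen_meet {U : Set X} (hU : IsOpen U) :
    IsOpen {A : VHyper X | (A.carrier ∩ U).Nonempty} := by
  classical
  refine isOpen_generateFrom_of_mem ⟨{univ, U}, by simpa using hU, ?_⟩
  ext A
  simp [vbox, A.nonempty']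

/-- Comparison with Mathlib's hyperspace. -/
def homeo : VHyper X ≃ₜ NonemptyCompacts X where
  toFun A := ⟨⟨A.carrier, A.isCompact'⟩, A.nonempty'⟩
  invFun K := ⟨K, K.isCompact, K.nonempty⟩
  left_inv A := rfl
  right_inv K := rfl
  continuous_toFun := by
    let _ := TopologicalSpace.vietoris X
    rw [(NonemptyCompacts.isEmbedding_coe (α := X)).continuous_iff]
    refine continuous_generateFrom_iff.2 ?_
    rintro _ (⟨U, hU, rfl⟩ | ⟨U, hU, rfl⟩)
    · exact isOpen_sub hU
    · exact isOpen_meet hU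
  continuous_invFun := by
    refine continuous_generateFrom_iff.2 ?_
    rintro _ ⟨Ps, hP, rfl⟩
    have h1 := NonemptyCompacts.isOpen_subsets_of_isOpen (isOpen_sUnion (s := (Ps : Set (Set X))) hP)
    have h2 := Ps.finite_toSet.isOpen_biInter fun U hU =>
      NonemptyCompacts.isOpen_inter_nonempty_of_isOpen (hP U hU)
    convert! h1.inter h2 using 1
    ext K
    simp [vbox]

/-- Singleton embedding. -/
def single (x : X) : VHyper X := ⟨{x}, isCompact_singleton, singleton_nonempty x⟩

theorem isClosedEmbedding_single [T2Space X] : IsClosedEmbedding (single : X → VHyper X) :=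
  (homeo (X := X)).symm.isClosedEmbedding.comp NonemptyCompacts.isClosedEmbedding_singleton

/-- Adding a point. -/
def ins (K : VHyper X) (x : X) : VHyper X :=
  ⟨{x} ∪ K.carrier, isCompact_singleton.union K.isCompact', Nonempty.inl (singleton_nonempty x)⟩

theorem continuous_ins (K : VHyper X) : Continuous (ins K) := by
  have : Continuous fun x : X => (({x} : NonemptyCompacts X) ⊔ homeo K) :=
    NonemptyCompacts.continuous_singleton.sup continuous_const
  exact (homeo (X := X)).symm.continuous.comp this

theorem frechet [T2Space X] {W : VHyper X → Set (Set (VHyper X))} (hW : IsWeakBase W)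
    (hc : ∀ y, (W y).Countable) (A : Set X) : closure A ⊆ seqClosure A := by
  haveI : T2Space (VHyper X) := (homeo (X := X)).symm.t2Space
  have hemb := isClosedEmbedding_single (X := X)
  have key : IsSeqClosed (seqClosure A) := by
    intro x a hxA hxa
    by_cases hex : ∃ n, x n = a
    · obtain ⟨n, rfl⟩ := hex
      exact hxA n
    push Not at hex
    choose s hsA hs using hxA
    have hsep : ∀ n, ∃ U V : Set X, IsOpen U ∧ IsOpen V ∧ x n ∈ U ∧ a ∈ V ∧ Disjoint U V :=
      fun n => t2_separation (hex n)
    choose U V hU hV hxU haV hUV using hsep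
    let K : VHyper X := ⟨insert a (range x), hxa.isCompact_insert_range, insert_nonempty _ _⟩
    obtain ⟨p, hp, hpU⟩ := wb_seq hW K (hc K)
    have hins : ∀ j, ins K (x j) = K := by
      intro j
      have : ({x j} : Set X) ∪ K.carrier = K.carrier :=
        union_eq_right.2 (singleton_subset_iff.2 (Or.inr ⟨j, rfl⟩))
      simp only [ins, this]
    have hm : ∀ j, ∃ m, ins K (s j m) ∈ p j ∧ ∀ i < j, x j ∈ V i → s j m ∈ V i := by
      intro j
      have h1 : ∀ᶠ m in atTop, ins K (s j m) ∈ p j := by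
        refine wb_eventually hW (y := K) ?_ (hp j)
        have := ((continuous_ins K).tendsto (x j)).comp (hs j)
        rwa [hins] at this
      have h2 : ∀ᶠ m in atTop, ∀ i ∈ Iio j, x j ∈ V i → s j m ∈ V i := by
        rw [eventually_all_finite (finite_Iio j)]
        intro i _
        by_cases h : x j ∈ V i
        · filter_upwards [(hs j).eventually ((hV i).mem_nhds h)] with m hm _
          exact hm
        · exact Eventually.of_forall fun m h' => absurd h' h
      exact (h1.and h2).exists
    choose m hm1 hm2 using hm
    refine ⟨fun j => s j (m j), fun j => hsA j _, tendsto_nhds.2 fun O hO haO => ?_⟩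
    obtain ⟨N, hN⟩ := eventually_atTop.1 (hxa.eventually (hO.mem_nhds haO))
    have hopen : IsOpen (O ∪ ⋃ i ∈ Iio N, U i) :=
      hO.union (isOpen_biUnion fun i _ => hU i)
    have hKsub : K.carrier ⊆ O ∪ ⋃ i ∈ Iio N, U i := by
      rintro _ (rfl | ⟨n, rfl⟩)
      · exact Or.inl haO
      · by_cases hn : N ≤ n
        · exact Or.inl (hN n hn)
        · exact Or.inr (mem_biUnion (not_le.1 hn) (hxU n))
    have e1 := hpU _ ((isOpen_sub hopen).mem_nhds hKsub)
    have e2 : ∀ᶠ j in atTop, ∀ i ∈ Iio N, x j ∈ V i := by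
      rw [eventually_all_finite (finite_Iio N)]
      exact fun i _ => hxa.eventually ((hV i).mem_nhds (haV i))
    filter_upwards [e1, e2, eventually_ge_atTop N] with j h1 h2 h3
    have h4 : s j (m j) ∈ O ∪ ⋃ i ∈ Iio N, U i := h1 (hm1 j) (Or.inl rfl)
    rcases h4 with h4 | h4
    · exact h4
    · obtain ⟨i, hi, hiU⟩ := mem_iUnion₂.1 h4
      exact absurd (hm2 j i (lt_of_lt_of_le hi h3) (h2 i hi)) (disjoint_left.1 (hUV i) hiU)
  have hcl : IsClosed (seqClosure A) := by
    have : IsSeqClosed (single '' seqClosure A) := by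
      intro z L hz hL
      choose x hx hxz using hz
      obtain ⟨a, rfl⟩ : L ∈ range (single : X → VHyper X) :=
        hemb.isClosed_range.mem_of_tendsto hL (Eventually.of_forall fun n => ⟨x n, hxz n⟩)
      refine ⟨a, key hx ?_, rfl⟩
      rw [hemb.isEmbedding.tendsto_nhds_iff]
      convert! hL using 1
      exact funext hxz
    exact hemb.isClosed_iff_image_isClosed.2 (wb_seqClosed hW hc this)
  exact closure_minimal subset_seqClosure hcl

end VHyper

theorem metrizable_wb {Y : Type*} [TopologicalSpace Y] [MetrizableSpace Y] :
    ∃ W : Y → Set (Set Y), IsWeakBase W ∧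
      ∃ B : ℕ → Set (Set Y), (⋃ K, W K) = (⋃ n, B n) ∧ ∀ n, LocallyFiniteFam (B n) := by
  letI := metrizableSpaceMetric Y
  have h : ∀ n : ℕ, ∃ v : Y → Set Y, (∀ a, IsOpen (v a)) ∧ ⋃ i, v i = univ ∧
      LocallyFinite v ∧ ∀ a, v a ⊆ Metric.ball a (1 / (n + 1 : ℝ)) := fun n =>
    precise_refinement _ (fun a => Metric.isOpen_ball) (iUnion_eq_univ_iff.2 fun y =>
      ⟨y, Metric.mem_ball_self (by positivity)⟩)
  choose v hvo hvc hvf hvb using h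
  let B : ℕ → Set (Set Y) := fun n => {P | P ∈ range (v n) ∧ P.Nonempty}
  let W : Y → Set (Set Y) := fun y => {P | P ∈ ⋃ n, B n ∧ y ∈ P}
  have hWo : ∀ y, ∀ P ∈ W y, IsOpen P := by
    rintro y P ⟨hP, -⟩
    obtain ⟨n, ⟨a, rfl⟩, -⟩ := mem_iUnion.1 hP
    exact hvo n a
  have hb : ∀ y, ∀ U : Set Y, IsOpen U → y ∈ U → ∃ P ∈ W y, P ⊆ U := by
    intro y U hU hy
    obtain ⟨ε, hε, hεU⟩ := Metric.isOpen_iff.1 hU y hy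
    obtain ⟨n, hn⟩ := exists_nat_one_div_lt (half_pos hε)
    obtain ⟨a, ha⟩ := iUnion_eq_univ_iff.1 (hvc n) y
    refine ⟨v n a, ⟨mem_iUnion.2 ⟨n, ⟨a, rfl⟩, ⟨y, ha⟩⟩, ha⟩, fun z hz => hεU ?_⟩
    have h1 := Metric.mem_ball.1 (hvb n a ha)
    have h2 := Metric.mem_ball.1 (hvb n a hz)
    have := dist_triangle_right z y a
    rw [Metric.mem_ball]
    linarith
  refine ⟨W, ⟨fun y P hP => hP.2, fun y U hU V hV => hb y _ ((hWo y U hU).inter (hWo y V hV))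
    ⟨hU.2, hV.2⟩, hb, fun G hG => ?_⟩, B, ?_, fun n y => ?_⟩
  · rw [isOpen_iff_mem_nhds]
    intro y hy
    obtain ⟨P, hP, hPG⟩ := hG y hy
    exact mem_of_superset ((hWo y P hP).mem_nhds hP.2) hPG
  · ext P
    constructor
    · intro h
      obtain ⟨y, hy⟩ := mem_iUnion.1 h
      exact hy.1
    · intro h
      obtain ⟨n, hn, y, hy⟩ := mem_iUnion.1 h
      exact mem_iUnion.2 ⟨y, h, hy⟩
  · obtain ⟨t, ht, hfin⟩ := hvf n y
    refine ⟨t, ht, (hfin.image (v n)).subset ?_⟩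
    rintro _ ⟨⟨⟨a, rfl⟩, -⟩, hne⟩
    exact ⟨a, by rwa [inter_comm] at hne, rfl⟩

theorem wb_metrizable {X : Type*} [TopologicalSpace X] [T2Space X] [RegularSpace X]
    {W : VHyper X → Set (Set (VHyper X))} (hW : IsWeakBase W) {B : ℕ → Set (Set (VHyper X))}
    (hWB : (⋃ K, W K) = (⋃ n, B n)) (hB : ∀ n, LocallyFiniteFam (B n)) : MetrizableSpace X := by
  haveI : T2Space (VHyper X) := (VHyper.homeo (X := X)).symm.t2Space
  have hemb := VHyper.isClosedEmbedding_single (X := X)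
  have hc : ∀ K, (W K).Countable := by
    intro K
    have : W K ⊆ ⋃ n, {P ∈ B n | K ∈ P} := by
      intro P hP
      have h : P ∈ ⋃ n, B n := hWB ▸ mem_iUnion.2 ⟨K, hP⟩
      obtain ⟨n, hn⟩ := mem_iUnion.1 h
      exact mem_iUnion.2 ⟨n, hn, hW.1 K P hP⟩
    refine (countable_iUnion fun n => Set.Finite.countable ?_).mono this
    obtain ⟨O, hO, hfin⟩ := hB n K
    exact hfin.subset fun P hP => ⟨hP.1, K, mem_of_mem_nhds hO, hP.2⟩
  have hnhds : ∀ x : X, ∀ P ∈ W (VHyper.single x), VHyper.single ⁻¹' P ∈ 𝓝 x := by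
    intro x P hP
    by_contra hcon
    have hx : x ∈ closure (VHyper.single ⁻¹' P)ᶜ := by
      rw [closure_compl]
      exact fun h => hcon (mem_interior_iff_mem_nhds.1 h)
    obtain ⟨s, hs, hsx⟩ := VHyper.frechet hW hc _ hx
    obtain ⟨k, hk⟩ := (wb_eventually hW ((hemb.continuous.tendsto x).comp hsx) hP).exists
    exact hs k hk
  refine nagata_smirnov_aux (I := fun n => B n) (fun n P => interior (VHyper.single ⁻¹' P.1))
    (fun n i => isOpen_interior) (fun n x => ?_) (fun x O hO => ?_)
  · obtain ⟨O, hO, hfin⟩ := hB n (VHyper.single x)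
    refine ⟨VHyper.single ⁻¹' O, hemb.continuous.continuousAt hO, ?_⟩
    refine Set.Finite.subset (hfin.preimage (f := fun P : B n => P.1)
      Subtype.val_injective.injOn) ?_
    rintro P ⟨y, hyP, hyO⟩
    exact ⟨P.2, VHyper.single y, hyO, interior_subset (s := VHyper.single ⁻¹' P.1) hyP⟩
  · obtain ⟨V, hVO, hV, hxV⟩ := mem_nhds_iff.1 hO
    obtain ⟨P, hP, hPV⟩ := hW.2.2.1 (VHyper.single x) _ (VHyper.isOpen_sub hV)
      (singleton_subset_iff.2 hxV)
    have h : P ∈ ⋃ n, B n := hWB ▸ mem_iUnion.2 ⟨_, hP⟩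
    obtain ⟨n, hn⟩ := mem_iUnion.1 h
    refine ⟨n, ⟨P, hn⟩, mem_interior_iff_mem_nhds.2 (hnhds x P hP), fun y hy => hVO ?_⟩
    have : VHyper.single y ∈ P := interior_subset (s := VHyper.single ⁻¹' P) hy
    exact hPV this rfl

/-- TFAE: `X` is metrizable; `𝒦(X)` has a σ-locally finite weak base; `𝒦(X)` is
metrizable. -/
theorem statement10 {X : Type*} [TopologicalSpace X] [T2Space X] [RegularSpace X] :
    List.TFAE
      [MetrizableSpace X,
       ∃ W : VHyper X → Set (Set (VHyper X)), IsWeakBase W ∧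
         ∃ B : ℕ → Set (Set (VHyper X)), (⋃ K, W K) = (⋃ n, B n) ∧
           ∀ n, LocallyFiniteFam (B n),
       MetrizableSpace (VHyper X)] := by
  tfae_have 1 → 3 := by
    intro h
    letI := metrizableSpaceMetric X
    haveI : MetrizableSpace (NonemptyCompacts X) := inferInstance
    exact (VHyper.homeo (X := X)).isEmbedding.metrizableSpace
  tfae_have 3 → 2 := fun h => metrizable_wb
  tfae_have 2 → 1 := by
    rintro ⟨W, hW, B, hWB, hB⟩
    exact wb_metrizable hW hWB hB
  tfae_finish
end

section
/- A regular T2 space X is an α-space if and only if the hyperspace 𝒦(X) with the Vietoris topology is an α-space. -/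
open TopologicalSpace Set

/-- An α-space (σ#-space): there is `g : ℕ × Y → τ_Y` with `y ∈ g n y`, `⋂ n, g n y = {y}`,
and `z ∈ g n y → g n z ⊆ g n y`. -/
def IsAlphaSpace (Y : Type*) [TopologicalSpace Y] : Prop :=
  ∃ g : ℕ → Y → Set Y,
    (∀ n y, IsOpen (g n y)) ∧ (∀ n y, y ∈ g n y) ∧
    (∀ y : Y, ⋂ n, g n y = {y}) ∧
    (∀ n y z, z ∈ g n y → g n z ⊆ g n y)

section AlphaHelpers

variable {X : Type*} [TopologicalSpace X]

theorem VHyper.isOpen_vbox {Ps : Finset (Set X)} (h : ∀ U ∈ Ps, IsOpen U) :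
    IsOpen (VHyper.vbox Ps) :=
  TopologicalSpace.isOpen_generateFrom_of_mem ⟨Ps, h, rfl⟩

theorem VHyper.isOpen_sub_s11 {U : Set X} (h : IsOpen U) :
    IsOpen {M : VHyper X | M.carrier ⊆ U} := by
  have := VHyper.isOpen_vbox (Ps := {U}) (by simpa using h)
  convert this using 1
  ext M
  simp only [VHyper.vbox, mem_setOf_eq, Finset.coe_singleton, sUnion_singleton,
    Finset.mem_singleton, forall_eq]
  constructor
  · intro hM
    refine ⟨hM, ?_⟩
    obtain ⟨x, hx⟩ := M.nonempty'
    exact ⟨x, hx, hM hx⟩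
  · exact fun hM => hM.1

theorem VHyper.isOpen_meet_s11 {U : Set X} (h : IsOpen U) :
    IsOpen {M : VHyper X | (M.carrier ∩ U).Nonempty} := by
  classical
  have := VHyper.isOpen_vbox (Ps := {univ, U}) (by
    intro V hV
    simp only [Finset.mem_insert, Finset.mem_singleton] at hV
    rcases hV with rfl | rfl
    · exact isOpen_univ
    · exact h)
  convert this using 1
  ext M
  simp only [VHyper.vbox, mem_setOf_eq]
  constructor
  · intro hM
    refine ⟨fun x _ => ⟨univ, by simp, trivial⟩, ?_⟩
    intro V hV
    simp only [Finset.mem_insert, Finset.mem_singleton] at hV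
    rcases hV with rfl | rfl
    · simpa using M.nonempty'
    · exact hM
  · intro hM
    exact hM.2 U (by simp)

theorem VHyper.ext_carrier {K L : VHyper X} (h : K.carrier = L.carrier) : K = L := by
  cases K; cases L; cases h; rfl

theorem alpha_of_hyper (H : IsAlphaSpace (VHyper X)) : IsAlphaSpace X := by
  obtain ⟨G, h1, h2, h3, h4⟩ := H
  let i : X → VHyper X := fun x => ⟨{x}, isCompact_singleton, singleton_nonempty x⟩
  have hi : Continuous i := by
    refine continuous_generateFrom_iff.2 ?_
    rintro _ ⟨Ps, hPs, rfl⟩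
    have : i ⁻¹' VHyper.vbox Ps = ⋃₀ (Ps : Set (Set X)) ∩ ⋂ P ∈ Ps, P := by
      ext x
      simp [i, VHyper.vbox]
    rw [this]
    exact (isOpen_sUnion hPs).inter (isOpen_biInter_finset hPs)
  have hinj : ∀ x y, i x = i y → x = y := by
    intro x y h
    have := congrArg VHyper.carrier h
    simpa [i] using this
  refine ⟨fun n x => i ⁻¹' G n (i x), fun n x => (h1 n _).preimage hi, fun n x => h2 n _, ?_, ?_⟩
  · intro x
    ext y
    constructor
    · intro hy
      have : i y ∈ ⋂ n, G n (i x) := by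
        simpa using hy
      rw [h3] at this
      exact hinj _ _ this
    · rintro rfl
      simp [h2]
  · intro n x y hy z hz
    exact h4 n _ _ hy hz

/-- compact separation -/
theorem sepA (g : ℕ → X → Set X) (ho : ∀ n x, IsOpen (g n x)) (hm : ∀ n x, x ∈ g n x)
    (hI : ∀ x, ⋂ n, g n x = {x}) (ht : ∀ n y z, z ∈ g n y → g n z ⊆ g n y)
    (ha : ∀ x m n, m ≤ n → g n x ⊆ g m x)
    (D : Set X) (hD : IsCompact D) (l : X) (hl : l ∉ D) :
    ∃ m, ∀ n, m ≤ n → ∀ d ∈ D, l ∉ g n d := by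
  have h1 : ∀ d ∈ D, ∃ m, l ∉ g m d := by
    intro d hd
    by_contra! hc
    have : l ∈ ⋂ n, g n d := by simpa using hc
    rw [hI] at this
    rw [mem_singleton_iff] at this
    exact hl (this ▸ hd)
  choose! f hf using h1
  obtain ⟨s, hsD, hs⟩ := hD.elim_nhds_subcover (fun d => g (f d) d)
    (fun d _ => (ho _ d).mem_nhds (hm _ d))
  refine ⟨s.sup f, fun n hn d hd hld => ?_⟩
  obtain ⟨e, he, hde⟩ := mem_iUnion₂.1 (hs hd)
  have : f e ≤ n := (Finset.le_sup he).trans hn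
  exact hf e (hsD e he) (ht _ _ _ hde (ha _ _ _ this hld))

theorem refB [RegularSpace X] (g : X → Set X) (ho : ∀ x, IsOpen (g x)) (hm : ∀ x, x ∈ g x)
    (ht : ∀ y z, z ∈ g y → g z ⊆ g y) :
    ∃ (g' h : X → Set X), (∀ x, IsOpen (g' x)) ∧ (∀ x, x ∈ g' x) ∧
      (∀ y z, z ∈ g' y → g' z ⊆ g' y) ∧ (∀ x, g' x ⊆ g x) ∧
      (∀ y z, y ∈ g' z → z ∈ g' y → h y = h z) ∧ (∀ x, IsOpen (h x)) ∧ (∀ x, x ∈ h x) ∧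
      (∀ x, closure (h x) ⊆ g x) := by
  classical
  have hreg : ∀ z, ∃ o : Set X, IsOpen o ∧ z ∈ o ∧ closure o ⊆ g z := by
    intro z
    obtain ⟨t, htn, htc, hts⟩ := exists_mem_nhds_isClosed_subset ((ho z).mem_nhds (hm z))
    exact ⟨interior t, isOpen_interior, mem_interior_iff_mem_nhds.2 htn,
      (closure_minimal interior_subset htc).trans hts⟩
  choose o oo om oc using hreg
  obtain ⟨_, _⟩ := exists_wellOrder X
  have hne : ∀ z, {w | (w ∈ g z ∧ z ∈ g w) ∧ z ∈ o w}.Nonempty :=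
    fun z => ⟨z, ⟨hm z, hm z⟩, om z⟩
  let ρ : X → X := fun z => wellFounded_lt.min {w | (w ∈ g z ∧ z ∈ g w) ∧ z ∈ o w} (hne z)
  have hρ : ∀ z, (ρ z ∈ g z ∧ z ∈ g (ρ z)) ∧ z ∈ o (ρ z) := fun z =>
    wellFounded_lt.min_mem _ (hne z)
  have hmin : ∀ z w, w ∈ g z → z ∈ g w → z ∈ o w → ρ z ≤ w := fun z w a b c =>
    not_lt.1 (wellFounded_lt.not_lt_min {w | (w ∈ g z ∧ z ∈ g w) ∧ z ∈ o w}
      (show w ∈ {w | (w ∈ g z ∧ z ∈ g w) ∧ z ∈ o w} from ⟨⟨a, b⟩, c⟩))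
  clear_value ρ
  refine ⟨fun z => {z' | z' ∈ g z ∧ (z ∈ g z' → ρ z' ≤ ρ z)}, fun z => o (ρ z), ?_, ?_, ?_, ?_, ?_,
    fun x => oo _, fun x => (hρ x).2, ?_⟩
  · intro z
    rw [isOpen_iff_mem_nhds]
    rintro z' ⟨h1, h2⟩
    by_cases hz : z ∈ g z'
    · filter_upwards [(ho z).mem_nhds h1, (oo (ρ z')).mem_nhds (hρ z').2] with w hw1 hw2
      refine ⟨hw1, fun hzw => (hmin w (ρ z') ?_ ?_ hw2).trans (h2 hz)⟩
      · exact ht _ _ hzw (ht _ _ h1 (hρ z').1.1)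
      · exact ht _ _ (hρ z').1.2 (ht _ _ hz hw1)
    · filter_upwards [(ho z').mem_nhds (hm z')] with w hw
      exact ⟨ht _ _ h1 hw, fun hzw => absurd (ht _ _ hw hzw) hz⟩
  · exact fun x => ⟨hm x, fun _ => le_rfl⟩
  · rintro z z' ⟨h1, h2⟩ z'' ⟨h3, h4⟩
    refine ⟨ht _ _ h1 h3, fun hz => ?_⟩
    exact (h4 (ht _ _ hz h1)).trans (h2 (ht _ _ h3 hz))
  · exact fun x y hy => hy.1
  · rintro y z ⟨h1, h2⟩ ⟨h3, h4⟩
    have : ρ y = ρ z := le_antisymm (h2 h3) (h4 h1)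
    simp only [this]
  · exact fun x => (oc _).trans (ht _ _ (hρ x).1.1)

def aU (P : X → Set X) (K : Set X) : Set X := ⋃ x ∈ K, P x

def aH (P g' : X → Set X) (K : Set X) : Set X := {l | ∀ z ∈ K, l ∈ P z → z ∈ g' l}

def aV (h : X → Set X) (t : Set X) : Set X := ⋃ l ∈ t, h l

def aG (P g' h : X → Set X) (K : VHyper X) : Set (VHyper X) :=
  {M | M.carrier ⊆ aU P K.carrier ∧ ∀ t : Set X, t ⊆ aH P g' K.carrier → t ⊆ aU P M.carrier →
    ¬ K.carrier ⊆ closure (aV h t) → ¬ M.carrier ⊆ closure (aV h t)}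

theorem aU_mono (P : X → Set X) (ht : ∀ y z, z ∈ P y → P z ⊆ P y) {K M : Set X}
    (h : M ⊆ aU P K) : aU P M ⊆ aU P K := by
  intro y hy
  obtain ⟨z, hz, hyz⟩ := mem_iUnion₂.1 hy
  obtain ⟨w, hw, hzw⟩ := mem_iUnion₂.1 (h hz)
  exact mem_iUnion₂.2 ⟨w, hw, ht _ _ hzw hyz⟩

theorem sub_aU (P : X → Set X) (hm : ∀ x, x ∈ P x) (K : Set X) : K ⊆ aU P K :=
  fun x hx => mem_iUnion₂.2 ⟨x, hx, hm x⟩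

theorem aG_self (P g' h : X → Set X) (hm : ∀ x, x ∈ P x) (K : VHyper X) : K ∈ aG P g' h K :=
  ⟨sub_aU P hm _, fun _ _ _ a => a⟩

theorem aG_trans (P g' h : X → Set X) (ht : ∀ y z, z ∈ P y → P z ⊆ P y)
    (ht' : ∀ y z, z ∈ g' y → g' z ⊆ g' y) (hPg : ∀ x, P x ⊆ g' x) (K M : VHyper X)
    (hM : M ∈ aG P g' h K) : aG P g' h M ⊆ aG P g' h K := by
  rintro M' ⟨h1, h2⟩
  refine ⟨h1.trans (aU_mono P ht hM.1), fun t t1 t2 hK => ?_⟩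
  have t3 := t2.trans (aU_mono P ht h1)
  refine h2 t ?_ t2 (hM.2 t t1 t3 hK)
  intro l hl z hz hlz
  obtain ⟨w, hw, hzw⟩ := mem_iUnion₂.1 (hM.1 hz)
  exact ht' _ _ (t1 hl w hw (ht _ _ hzw hlz)) (hPg _ hzw)

theorem aG_open (P g' h : X → Set X) (ho : ∀ x, IsOpen (P x)) (hm : ∀ x, x ∈ P x)
    (ht : ∀ y z, z ∈ P y → P z ⊆ P y)
    (ht' : ∀ y z, z ∈ g' y → g' z ⊆ g' y) (hPg : ∀ x, P x ⊆ g' x)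
    (hh : ∀ y z, y ∈ g' z → z ∈ g' y → h y = h z) (K : VHyper X) :
    IsOpen (aG P g' h K) := by
  classical
  rw [isOpen_iff_mem_nhds]
  intro M hM
  refine Filter.mem_of_superset ?_ (aG_trans P g' h ht ht' hPg K M hM)
  clear hM K
  obtain ⟨s, hsK, hs⟩ := M.isCompact'.elim_nhds_subcover P (fun d _ => (ho d).mem_nhds (hm d))
  have hU : IsOpen (aU P M.carrier) := isOpen_biUnion fun x _ => ho x
  have hfin : ∀ τ ∈ s.powerset, ∀ᶠ L : VHyper X in nhds M, ¬ M.carrier ⊆ closure (aV h ↑τ) →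
      ¬ L.carrier ⊆ closure (aV h ↑τ) := by
    intro τ _
    by_cases hc : M.carrier ⊆ closure (aV h ↑τ)
    · exact Filter.Eventually.of_forall fun L hL => absurd hc hL
    · obtain ⟨x, hx, hx'⟩ := not_subset.1 hc
      filter_upwards [(VHyper.isOpen_meet_s11 (isClosed_closure (s := aV h ↑τ)).isOpen_compl).mem_nhds
        (show M ∈ _ from ⟨x, hx, hx'⟩)] with L hL _ hL2
      obtain ⟨y, hy, hy'⟩ := hL
      exact hy' (hL2 hy)
  have hfin' := (Filter.eventually_all_finset s.powerset).2 hfin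
  filter_upwards [(VHyper.isOpen_sub_s11 hU).mem_nhds (sub_aU P hm _ : M.carrier ⊆ _), hfin']
    with L hL1 hL2
  refine ⟨hL1, fun t t1 t2 => ?_⟩
  have t3 := t2.trans (aU_mono P ht hL1)
  have key : ∀ l ∈ t, ∀ x ∈ s, l ∈ P x → h l = h x := fun l hl x hx hlx =>
    hh _ _ (hPg _ hlx) (t1 hl x (hsK x hx) hlx)
  have hV : aV h t = aV h ↑(s.filter fun x => ∃ l ∈ t, l ∈ P x) := by
    apply Subset.antisymm
    · intro y hy
      obtain ⟨l, hl, hyl⟩ := mem_iUnion₂.1 hy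
      obtain ⟨z, hz, hlz⟩ := mem_iUnion₂.1 (t3 hl)
      obtain ⟨x, hx, hzx⟩ := mem_iUnion₂.1 (hs hz)
      have hlx := ht _ _ hzx hlz
      refine mem_iUnion₂.2 ⟨x, ?_, key l hl x hx hlx ▸ hyl⟩
      simpa using ⟨hx, l, hl, hlx⟩
    · intro y hy
      obtain ⟨x, hx, hyx⟩ := mem_iUnion₂.1 hy
      have hx2 : x ∈ s ∧ ∃ l ∈ t, l ∈ P x := by simpa using hx
      obtain ⟨hxs, l, hl, hlx⟩ := hx2
      exact mem_iUnion₂.2 ⟨l, hl, (key l hl x hxs hlx).symm ▸ hyx⟩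
  rw [hV]
  exact hL2 _ (Finset.mem_powerset.2 (Finset.filter_subset _ _))

theorem hyper_of_alpha [RegularSpace X] (H : IsAlphaSpace X) : IsAlphaSpace (VHyper X) := by
  classical
  obtain ⟨g₀, o₀, m₀, i₀, t₀⟩ := H
  obtain ⟨g, ho, hm, hI, ht, ha⟩ : ∃ g : ℕ → X → Set X, (∀ n x, IsOpen (g n x)) ∧
      (∀ n x, x ∈ g n x) ∧ (∀ x, ⋂ n, g n x = {x}) ∧ (∀ n y z, z ∈ g n y → g n z ⊆ g n y) ∧
      (∀ x m n, m ≤ n → g n x ⊆ g m x) := by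
    refine ⟨fun n x => ⋂ i ∈ Finset.range (n+1), g₀ i x, ?_, ?_, ?_, ?_, ?_⟩
    · exact fun n x => isOpen_biInter_finset fun i _ => o₀ i x
    · exact fun n x => mem_iInter₂.2 fun i _ => m₀ i x
    · intro x
      rw [← i₀ x]
      apply Subset.antisymm
      · intro y hy
        refine mem_iInter.2 fun n => ?_
        exact mem_iInter₂.1 (mem_iInter.1 hy n) n (by simp)
      · intro y hy
        exact mem_iInter.2 fun n => mem_iInter₂.2 fun i _ => mem_iInter.1 hy i
    · intro n y z hz w hw
      exact mem_iInter₂.2 fun i hi => t₀ i _ _ (mem_iInter₂.1 hz i hi) (mem_iInter₂.1 hw i hi)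
    · intro x m n hmn w hw
      refine mem_iInter₂.2 fun i hi => mem_iInter₂.1 hw i ?_
      simp only [Finset.mem_range] at hi ⊢
      omega
  clear i₀ t₀ m₀ o₀
  choose g' h go gm gt gg gh hho hhm hhc using fun k => refB (g k) (ho k) (hm k) (ht k)
  let P : ℕ → ℕ → X → Set X := fun k m x => g' k x ∩ g m x
  have Po : ∀ k m x, IsOpen (P k m x) := fun k m x => (go k x).inter (ho m x)
  have Pm : ∀ k m x, x ∈ P k m x := fun k m x => ⟨gm k x, hm m x⟩
  have Pt : ∀ k m y z, z ∈ P k m y → P k m z ⊆ P k m y := fun k m y z hz w hw =>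
    ⟨gt k _ _ hz.1 hw.1, ht m _ _ hz.2 hw.2⟩
  have Pg : ∀ k m x, P k m x ⊆ g' k x := fun k m x y hy => hy.1
  refine ⟨fun n K => aG (P n.unpair.1 n.unpair.2) (g' n.unpair.1) (h n.unpair.1) K,
    fun n K => aG_open _ _ _ (Po _ _) (Pm _ _) (Pt _ _) (gt _) (Pg _ _) (gh _) K,
    fun n K => aG_self _ _ _ (Pm _ _) K, ?_,
    fun n K M hM => aG_trans _ _ _ (Pt _ _) (gt _) (Pg _ _) K M hM⟩
  intro K
  apply Subset.antisymm
  swap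
  · rintro _ rfl
    exact mem_iInter.2 fun n => aG_self _ _ _ (Pm _ _) _
  intro L hL
  have hL' : ∀ k m, L ∈ aG (P k m) (g' k) (h k) K := by
    intro k m
    have := mem_iInter.1 hL (Nat.pair k m)
    simpa using this
  clear hL
  rw [mem_singleton_iff]
  apply VHyper.ext_carrier
  have hsub : L.carrier ⊆ K.carrier := by
    intro y hy
    by_contra hyK
    obtain ⟨m, hmm⟩ := sepA g ho hm hI ht ha K.carrier K.isCompact' y hyK
    obtain ⟨z, hz, hyz⟩ := mem_iUnion₂.1 ((hL' 0 m).1 hy)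
    exact hmm m le_rfl z hz hyz.2
  apply Subset.antisymm hsub
  intro x hx
  by_contra hxL
  obtain ⟨k, hk⟩ := sepA g ho hm hI ht ha L.carrier L.isCompact' x hxL
  obtain ⟨t, htL, htc⟩ := L.isCompact'.elim_nhds_subcover (h k)
    (fun d _ => (hho k d).mem_nhds (hhm k d))
  have hD : ∀ l, ∃ m, ∀ n, m ≤ n → ∀ d ∈ K.carrier \ g' k l, l ∉ g n d := fun l =>
    sepA g ho hm hI ht ha _ (K.isCompact'.diff (go k l)) l (fun hl => hl.2 (gm k l))
  choose f hf using hD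
  refine (hL' k (t.sup f)).2 ↑t ?_ ?_ ?_ ?_
  · intro l hl z hz hlz
    by_contra hc
    exact hf l _ (Finset.le_sup (Finset.mem_coe.1 hl)) z ⟨hz, hc⟩ hlz.2
  · exact fun l hl => sub_aU _ (Pm _ _) _ (htL l hl)
  · intro hc
    have hxc := hc hx
    have : closure (aV (h k) ↑t) = ⋃ l ∈ t, closure (h k l) := by
      simp only [aV, Finset.mem_coe]
      exact t.finite_toSet.closure_biUnion (f := h k)
    rw [this] at hxc
    obtain ⟨l, hl, hxl⟩ := mem_iUnion₂.1 hxc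
    exact hk k le_rfl l (htL l hl) (hhc k l hxl)
  · refine Subset.trans ?_ subset_closure
    simpa [aV] using htc

end AlphaHelpers

/-- `X` is an α-space iff `𝒦(X)` is an α-space. -/
theorem statement11 {X : Type*} [TopologicalSpace X] [T2Space X] [RegularSpace X] :
    IsAlphaSpace X ↔ IsAlphaSpace (VHyper X) :=
  ⟨hyper_of_alpha, alpha_of_hyper⟩
end

section
/- A regular T2 space X has a W_δ-diagonal if and only if ℱ(X), the space of nonempty finite subsets of X with the Vietoris topology, has a W_δ-diagonal. -/
open TopologicalSpace Set

/-- A `W_δ`-diagonal: a sequence of bases such that every decreasing choice of members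
around a point intersects exactly in that point. -/
def HasWDeltaDiagonal (Y : Type*) [TopologicalSpace Y] : Prop :=
  ∃ B : ℕ → Set (Set Y), (∀ n, IsBaseFam (B n)) ∧
    ∀ (b : ℕ → Set Y) (y : Y), (∀ n, b n ∈ B n) → (∀ n, y ∈ b n) →
      (∀ n, b (n + 1) ⊆ b n) → (⋂ n, b n) = {y}

universe u

/-- A rooted sieve whose threads have at most one point in the intersection. -/
def HasDSieve (Y : Type u) [TopologicalSpace Y] : Prop :=
  ∃ (T : Type u) (r : T → T → Prop) (root : T) (G : T → Set Y),
    (∀ t, IsOpen (G t)) ∧ G root = univ ∧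
    (∀ t, ∀ y ∈ G t, ∃ s, r t s ∧ y ∈ G s) ∧
    (∀ t s, r t s → G s ⊆ G t) ∧
    (∀ s : ℕ → T, s 0 = root → (∀ n, r (s n) (s (n + 1))) → ∀ y z,
      (∀ n, y ∈ G (s n)) → (∀ n, z ∈ G (s n)) → y = z)

theorem HasDSieve.of_wdelta {Y : Type u} [TopologicalSpace Y] (h : HasWDeltaDiagonal Y) :
    HasDSieve Y := by
  obtain ⟨B, hB, hd⟩ := h
  refine ⟨ℕ × Opens Y, fun p q => q.1 = p.1 + 1 ∧ (q.2 : Set Y) ∈ B p.1 ∧ q.2 ≤ p.2,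
    (0, ⊤), fun p => (p.2 : Set Y), fun t => t.2.isOpen, rfl, ?_, ?_, ?_⟩
  · rintro ⟨n, U⟩ y hy
    obtain ⟨P, hP, hyP, hPU⟩ := (hB n).2 U U.isOpen y hy
    exact ⟨(n + 1, ⟨P, (hB n).1 P hP⟩), ⟨rfl, hP, hPU⟩, hyP⟩
  · rintro t s ⟨-, -, h⟩
    exact h
  · intro s h0 hs y z hy hz
    have hn : ∀ n, (s n).1 = n := by
      intro n
      induction n with
      | zero => rw [h0]
      | succ k ih => rw [(hs k).1, ih]
    have := hd (fun n => ((s (n + 1)).2 : Set Y)) y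
      (fun n => by have := (hs n).2.1; rwa [hn] at this) (fun n => hy (n + 1))
      (fun n => (hs (n + 1)).2.2)
    have hz' : z ∈ ⋂ n, ((s (n + 1)).2 : Set Y) := mem_iInter.2 fun n => hz (n + 1)
    rw [this] at hz'
    exact hz'.symm

theorem HasDSieve.wdelta {Y : Type u} [TopologicalSpace Y] (h : HasDSieve Y) :
    HasWDeltaDiagonal Y := by
  classical
  obtain ⟨T, r, root, G, hO, hroot, hex, hmono, hthr⟩ := h
  obtain ⟨_, _⟩ := exists_wellFoundedLT T
  have hnext : ∀ (y : Y) (t : T), ∃ s, y ∈ G t → (r t s ∧ y ∈ G s ∧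
      ∀ s', r t s' → y ∈ G s' → s ≤ s') := by
    intro y t
    by_cases hy : y ∈ G t
    · have hne : {s | r t s ∧ y ∈ G s}.Nonempty := hex t y hy
      refine ⟨wellFounded_lt.min _ hne, fun _ => ?_⟩
      have := wellFounded_lt.min_mem _ hne
      exact ⟨this.1, this.2, fun s' h1 h2 => not_lt.1 (wellFounded_lt.not_lt_min {s | r t s ∧ y ∈ G s} ⟨h1, h2⟩)⟩
    · exact ⟨t, fun h => absurd h hy⟩
  choose nx hnx using hnext
  let τ : ℕ → Y → T := fun n y => Nat.rec root (fun _ t => nx y t) n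
  have τ0 : ∀ y, τ 0 y = root := fun _ => rfl
  have τs : ∀ n y, τ (n + 1) y = nx y (τ n y) := fun _ _ => rfl
  have hτ : ∀ n y, y ∈ G (τ n y) := by
    intro n y
    induction n with
    | zero => rw [τ0, hroot]; trivial
    | succ k ih => rw [τs]; exact (hnx y _ ih).2.1
  have hr : ∀ n y, r (τ n y) (τ (n + 1) y) := fun n y => (hnx y _ (hτ n y)).1
  have hmin : ∀ n y s', r (τ n y) s' → y ∈ G s' → τ (n + 1) y ≤ s' :=
    fun n y => (hnx y _ (hτ n y)).2.2
  have hanti : ∀ y, Antitone fun n => G (τ n y) :=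
    fun y => antitone_nat_of_succ_le fun n => hmono _ _ (hr n y)
  refine ⟨fun n => {V | IsOpen V ∧ ∃ x ∈ V, V ⊆ G (τ n x)}, fun n => ⟨fun P hP => hP.1, ?_⟩, ?_⟩
  · intro U hU y hy
    exact ⟨U ∩ G (τ n y), ⟨hU.inter (hO _), y, ⟨hy, hτ n y⟩, inter_subset_right⟩,
      ⟨hy, hτ n y⟩, inter_subset_left⟩
  intro b y hb hy hdec
  have hbanti : Antitone b := antitone_nat_of_succ_le hdec
  choose x hxb hxG using fun n => (hb n).2
  have key : ∀ k, ∃ s N, ∀ n ≥ N, τ k (x n) = s := by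
    intro k
    induction k with
    | zero => exact ⟨root, 0, fun n _ => τ0 (x n)⟩
    | succ k ih =>
      obtain ⟨s, N, hN⟩ := ih
      let M := max N (k + 1)
      have hle : ∀ m ≥ M, ∀ n ≥ m, τ (k + 1) (x n) ≤ τ (k + 1) (x m) := by
        intro m hm n hn
        have hmN : m ≥ N := le_trans (le_max_left _ _) hm
        have hmk : k + 1 ≤ m := le_trans (le_max_right _ _) hm
        apply hmin
        · have := hr k (x m)
          rwa [hN m hmN, ← hN n (hmN.trans hn)] at this
        · exact hanti (x m) hmk (hxG m (hbanti hn (hxb n)))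
      have hne : ((fun m => τ (k + 1) (x m)) '' {m | M ≤ m}).Nonempty := ⟨_, M, le_refl M, rfl⟩
      obtain ⟨m, hm, hmeq⟩ := wellFounded_lt.min_mem _ hne
      refine ⟨τ (k + 1) (x m), m, fun n hn => le_antisymm (hle m hm n hn) ?_⟩
      have := wellFounded_lt.not_lt_min ((fun m => τ (k + 1) (x m)) '' {m | M ≤ m})
        ⟨n, le_trans hm hn, rfl⟩
      rw [← hmeq] at this
      exact not_lt.1 this
  choose s N hN using key
  have hsub : ∀ k, ⋂ n, b n ⊆ G (s k) := by
    intro k z hz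
    have h1 := hN k (max (N k) k) (le_max_left _ _)
    rw [← h1]
    exact hanti _ (le_max_right _ _) (hxG _ (mem_iInter.1 hz _))
  have hyb : y ∈ ⋂ n, b n := mem_iInter.2 hy
  refine subset_antisymm ?_ (singleton_subset_iff.2 hyb)
  intro z hz
  refine hthr s ?_ ?_ z y (fun k => hsub k hz) (fun k => hsub k hyb)
  · rw [← hN 0 _ le_rfl, τ0]
  · intro k
    have h := hr k (x (max (N k) (N (k + 1))))
    rwa [hN k _ (le_max_left _ _), hN (k + 1) _ (le_max_right _ _)] at h

theorem HasDSieve.of_injective {X Y : Type u} [TopologicalSpace X] [TopologicalSpace Y]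
    (f : X → Y) (hf : Continuous f) (hi : Function.Injective f) (h : HasDSieve Y) :
    HasDSieve X := by
  obtain ⟨T, r, root, G, hO, hroot, hex, hmono, hthr⟩ := h
  exact ⟨T, r, root, fun t => f ⁻¹' G t, fun t => (hO t).preimage hf, by simp [hroot],
    fun t y hy => hex t (f y) hy, fun t s h => preimage_mono (hmono t s h),
    fun s h0 hs y z hy hz => hi (hthr s h0 hs _ _ hy hz)⟩

theorem finite_pigeon {α : Type*} {S : Set α} (hS : S.Finite) (Q : ℕ → α → Prop)
    (hQ : ∀ k a, Q (k + 1) a → Q k a) (h : ∀ k, ∃ a ∈ S, Q k a) : ∃ a ∈ S, ∀ k, Q k a := by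
  by_contra! hc
  have hQ' : ∀ k l a, k ≤ l → Q l a → Q k a := by
    intro k l a hkl
    induction hkl with
    | refl => exact id
    | step _ ih => exact fun hq => ih (hQ _ _ hq)
  choose! f hf using hc
  obtain ⟨M, hM⟩ := (hS.image f).bddAbove
  obtain ⟨a, ha, hq⟩ := h M
  exact hf a ha (hQ' _ _ _ (hM (mem_image_of_mem f ha)) hq)

/-- Chains of length `k` below `t`. -/
def konigP {T : Type*} (r : T → T → Prop) (D : ℕ → T → Prop) : ℕ → ℕ → T → Prop
  | 0, n, t => D n t
  | k + 1, n, t => D n t ∧ ∃ s, r t s ∧ konigP r D k (n + 1) s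

theorem konig_thread {T : Type*} (r : T → T → Prop) (D : ℕ → T → Prop) 
    (hfin : ∀ n, {t | D n t}.Finite) (hne : ∀ n, ∃ t, D n t)
    (hpar : ∀ n s, D (n + 1) s → ∃ t, D n t ∧ r t s) :
    ∃ s : ℕ → T, (∀ n, D n (s n)) ∧ ∀ n, r (s n) (s (n + 1)) := by
  have hD : ∀ k n t, konigP r D k n t → D n t := by
    intro k n t h
    cases k with
    | zero => exact h
    | succ k => exact h.1
  have hdec : ∀ k n t, konigP r D (k + 1) n t → konigP r D k n t := by
    intro k
    induction k with
    | zero => exact fun n t h => h.1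
    | succ k ih => exact fun n t ⟨h, s, hs, h'⟩ => ⟨h, s, hs, ih _ _ h'⟩
  have hex : ∀ k n, ∃ t, konigP r D k n t := by
    intro k
    induction k with
    | zero => exact hne
    | succ k ih =>
      intro n
      obtain ⟨s, hs⟩ := ih (n + 1)
      obtain ⟨t, ht, hr⟩ := hpar n s (hD _ _ _ hs)
      exact ⟨t, ht, s, hr, hs⟩
  have h0 : ∃ t ∈ {t | D 0 t}, ∀ k, konigP r D k 0 t :=
    finite_pigeon (hfin 0) (fun k t => konigP r D k 0 t) (fun k t => hdec k 0 t)
      fun k => by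
        obtain ⟨t, ht⟩ := hex k 0
        exact ⟨t, hD _ _ _ ht, ht⟩
  have hstep : ∀ n t, (∀ k, konigP r D k n t) → ∃ s, r t s ∧ ∀ k, konigP r D k (n + 1) s := by
    intro n t h
    obtain ⟨s, -, hs⟩ := finite_pigeon (hfin (n + 1)) (fun k s => r t s ∧ konigP r D k (n + 1) s)
      (fun k s h => ⟨h.1, hdec _ _ _ h.2⟩) fun k => by
        obtain ⟨-, s, hs, h'⟩ := h (k + 1)
        exact ⟨s, hD _ _ _ h', hs, h'⟩
    exact ⟨s, (hs 0).1, fun k => (hs k).2⟩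
  obtain ⟨t0, -, ht0⟩ := h0
  choose! nx hnx using hstep
  let σ : ℕ → T := fun n => Nat.rec t0 (fun n t => nx n t) n
  have hσ : ∀ n k, konigP r D k n (σ n) := by
    intro n
    induction n with
    | zero => exact ht0
    | succ n ih => exact (hnx n _ ih).2
  exact ⟨σ, fun n => hσ n 0, fun n => (hnx n _ (hσ n)).1⟩

theorem HasDSieve.vfin {X : Type u} [TopologicalSpace X] (h : HasDSieve X) :
    HasDSieve (VFin X) := by
  classical
  obtain ⟨T, r, root, G, hO, hroot, hex, hmono, hthr⟩ := h
  refine ⟨Finset T, fun S S' => (∀ s ∈ S', ∃ t ∈ S, r t s) ∧ (∀ t ∈ S, ∃ s ∈ S', r t s),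
    {root}, fun S => {A | (∀ x ∈ A.1.carrier, ∃ t ∈ S, x ∈ G t) ∧
      ∀ t ∈ S, ∃ x ∈ A.1.carrier, x ∈ G t}, ?_, ?_, ?_, ?_, ?_⟩
  · intro S
    have : IsOpen (VHyper.vbox (S.image G)) :=
      isOpen_generateFrom_of_mem ⟨S.image G, by simpa using fun a _ => hO a, rfl⟩
    have h2 : IsOpen ((fun A : VFin X => A.1) ⁻¹' (VHyper.vbox (S.image G))) :=
      this.preimage continuous_subtype_val
    convert h2 using 1
    ext A
    simp [VHyper.vbox, subset_def, Set.Nonempty]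
  · ext A
    simpa [hroot, Set.Nonempty] using A.1.nonempty'
  · rintro S A ⟨hA1, hA2⟩
    choose! c hc using hex
    refine ⟨(S ×ˢ A.2.toFinset).filter (fun p => p.2 ∈ G p.1) |>.image (fun p => c p.1 p.2),
      ⟨?_, ?_⟩, ?_, ?_⟩
    · intro s hs
      simp only [Finset.mem_image, Finset.mem_filter, Finset.mem_product, Prod.exists] at hs
      obtain ⟨t, x, ⟨⟨ht, hx⟩, hxt⟩, rfl⟩ := hs
      exact ⟨t, ht, (hc t x hxt).1⟩
    · intro t ht
      obtain ⟨x, hx, hxt⟩ := hA2 t ht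
      refine ⟨c t x, ?_, (hc t x hxt).1⟩
      simp only [Finset.mem_image, Finset.mem_filter, Finset.mem_product, Prod.exists]
      exact ⟨t, x, ⟨⟨ht, by simpa using hx⟩, hxt⟩, rfl⟩
    · intro x hx
      obtain ⟨t, ht, hxt⟩ := hA1 x hx
      refine ⟨c t x, ?_, (hc t x hxt).2⟩
      simp only [Finset.mem_image, Finset.mem_filter, Finset.mem_product, Prod.exists]
      exact ⟨t, x, ⟨⟨ht, by simpa using hx⟩, hxt⟩, rfl⟩
    · intro s hs
      simp only [Finset.mem_image, Finset.mem_filter, Finset.mem_product, Prod.exists] at hs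
      obtain ⟨t, x, ⟨⟨ht, hx⟩, hxt⟩, rfl⟩ := hs
      exact ⟨x, by simpa using hx, (hc t x hxt).2⟩
  · rintro S S' ⟨h1, h2⟩ A ⟨hA1, hA2⟩
    refine ⟨fun x hx => ?_, fun t ht => ?_⟩
    · obtain ⟨s, hs, hxs⟩ := hA1 x hx
      obtain ⟨t, ht, hr⟩ := h1 s hs
      exact ⟨t, ht, hmono _ _ hr hxs⟩
    · obtain ⟨s, hs, hr⟩ := h2 t ht
      obtain ⟨x, hx, hxs⟩ := hA2 s hs
      exact ⟨x, hx, hmono _ _ hr hxs⟩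
  · intro S h0 hS
    have main : ∀ A C : VFin X,
        (∀ n, (∀ x ∈ A.1.carrier, ∃ t ∈ S n, x ∈ G t) ∧
          ∀ t ∈ S n, ∃ x ∈ A.1.carrier, x ∈ G t) →
        (∀ n, (∀ x ∈ C.1.carrier, ∃ t ∈ S n, x ∈ G t) ∧
          ∀ t ∈ S n, ∃ x ∈ C.1.carrier, x ∈ G t) → A.1.carrier ⊆ C.1.carrier := by
      intro A C hA hC x hx
      obtain ⟨s, hs, hr⟩ := konig_thread r (fun n t => t ∈ S n ∧ x ∈ G t)
        (fun n => (S n).finite_toSet.subset fun t ht => ht.1) (fun n => (hA n).1 x hx)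
        (fun n s hs => by
          obtain ⟨t, ht, hr⟩ := (hS n).1 s hs.1
          exact ⟨t, ⟨ht, hmono _ _ hr hs.2⟩, hr⟩)
      obtain ⟨z, hz, hzG⟩ := finite_pigeon C.2 (fun n z => z ∈ G (s n))
        (fun n z h => hmono _ _ (hr n) h) (fun n => (hC n).2 _ (hs n).1)
      have h00 : s 0 = root := by
        have := (hs 0).1
        rw [h0] at this
        simpa using this
      rw [hthr s h00 hr x z (fun n => (hs n).2) hzG]
      exact hz
    intro A C hA hC
    have heq : A.1.carrier = C.1.carrier := subset_antisymm (main A C hA hC) (main C A hC hA)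
    obtain ⟨⟨a, _, _⟩, _⟩ := A
    obtain ⟨⟨c, _, _⟩, _⟩ := C
    simp only at heq
    subst heq
    rfl

/-- The singleton map. -/
def vsing {X : Type u} [TopologicalSpace X] (x : X) : VFin X :=
  ⟨⟨{x}, isCompact_singleton, singleton_nonempty x⟩, finite_singleton x⟩

theorem vsing_continuous {X : Type u} [TopologicalSpace X] :
    Continuous (vsing : X → VFin X) := by
  refine Continuous.subtype_mk (continuous_generateFrom_iff.2 ?_) _
  rintro _ ⟨Ps, hPs, rfl⟩
  have : (fun x : X => (⟨{x}, isCompact_singleton, singleton_nonempty x⟩ : VHyper X)) ⁻¹'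
      (VHyper.vbox Ps) = (⋃₀ (Ps : Set (Set X))) ∩ ⋂ P ∈ Ps, P := by
    ext x
    simp [VHyper.vbox]
  rw [this]
  exact (isOpen_sUnion hPs).inter (isOpen_biInter_finset hPs)

theorem vsing_injective {X : Type u} [TopologicalSpace X] :
    Function.Injective (vsing : X → VFin X) := by
  intro x y h
  have : ({x} : Set X) = {y} := congrArg (fun A : VFin X => A.1.carrier) h
  exact singleton_injective this

/-- `X` has a `W_δ`-diagonal iff `ℱ(X)` has a `W_δ`-diagonal. -/
theorem statement14 {X : Type*} [TopologicalSpace X] [T2Space X] [RegularSpace X] :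
    HasWDeltaDiagonal X ↔ HasWDeltaDiagonal (VFin X) :=
  ⟨fun h => (HasDSieve.of_wdelta h).vfin.wdelta,
    fun h => ((HasDSieve.of_wdelta h).of_injective vsing vsing_continuous vsing_injective).wdelta⟩
end
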